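/- Every large potential game possesses a pure strategy robust perfect equilibrium. -/

import Mathlib

open MeasureTheory Filter Topology

section RobustPerfect

variable {I : Type*} [MeasurableSpace I] {A : Type*} [Fintype A]

/-- The societal summary of a randomized strategy profile. -/
noncomputable def socSum (lam : Measure I) (h : I → A → ℝ) : A → ℝ :=
  fun a => ∫ i, h i a ∂lam

/-- `h` is a randomized strategy profile: a measurable map into the simplex. -/
def IsProfile (lam : Measure I) (h : I → A → ℝ) : Prop :=
  Measurable h ∧ ∀ i, h i ∈ stdSimplex ℝ A

/-- A large game: payoffs continuous on the simplex and measurable in the player. -/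
def IsLargeGame (u : I → A → (A → ℝ) → ℝ) : Prop :=
  (∀ i a, ContinuousOn (u i a) (stdSimplex ℝ A)) ∧
  (∀ (a : A) (τ : A → ℝ), τ ∈ stdSimplex ℝ A → Measurable fun i => u i a τ)

/-- An atomless measure. -/
def MeasAtomless (lam : Measure I) : Prop :=
  ∀ s : Set I, MeasurableSet s → 0 < lam s →
    ∃ t : Set I, MeasurableSet t ∧ t ⊆ s ∧ 0 < lam t ∧ lam t < lam s

/-- A Borel probability measure concentrated on the simplex with full support on it. -/
def FullSupportOnSimplex (η : Measure (A → ℝ)) : Prop :=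
  IsProbabilityMeasure η ∧ η (stdSimplex ℝ A)ᶜ = 0 ∧
    ∀ U : Set (A → ℝ), IsOpen U → (U ∩ stdSimplex ℝ A).Nonempty → 0 < η U

/-- A perturbation function: a Borel measurable map from the simplex to the
full-support Borel probability measures on the simplex. -/
def IsPerturbation (φ : (A → ℝ) → Measure (A → ℝ)) : Prop :=
  (∀ τ ∈ stdSimplex ℝ A, FullSupportOnSimplex (φ τ)) ∧
  ∀ f : (A → ℝ) → ℝ, Continuous f → Measurable fun τ => ∫ x, f x ∂(φ τ)

/-- Expected payoff of action `a` against a distribution over societal summaries. -/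
noncomputable def payM (ui : A → (A → ℝ) → ℝ) (a : A) (ν : Measure (A → ℝ)) : ℝ :=
  ∫ τ, ui a τ ∂ν

/-- Randomized strategy Nash equilibrium. -/
def IsNash (lam : Measure I) (u : I → A → (A → ℝ) → ℝ) (h : I → A → ℝ) : Prop :=
  IsProfile lam h ∧
  ∀ᵐ i ∂lam, ∀ μ ∈ stdSimplex ℝ A,
    ∑ a, μ a * u i a (socSum lam h) ≤ ∑ a, h i a * u i a (socSum lam h)

/-- A weakly dominated action. -/
def WeaklyDominated (ui : A → (A → ℝ) → ℝ) (a : A) : Prop :=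
  ∃ μ ∈ stdSimplex ℝ A,
    (∀ τ ∈ stdSimplex ℝ A, ui a τ ≤ ∑ b, μ b * ui b τ) ∧
    (∃ τ ∈ stdSimplex ℝ A, ui a τ < ∑ b, μ b * ui b τ)

/-- Admissibility: almost no player puts weight on a weakly dominated action. -/
def Admissible (lam : Measure I) (u : I → A → (A → ℝ) → ℝ) (h : I → A → ℝ) : Prop :=
  ∀ᵐ i ∂lam, ∀ a : A, WeaklyDominated (u i) a → h i a = 0

/-- Weak convergence of a sequence of measures to a Dirac measure. -/
def WeakTendstoDirac (ν : ℕ → Measure (A → ℝ)) (τ : A → ℝ) : Prop :=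
  ∀ f : (A → ℝ) → ℝ, Continuous f →
    Tendsto (fun n => ∫ x, f x ∂(ν n)) atTop (nhds (f τ))

/-- Aggregate robustness. -/
def AggregateRobust (lam : Measure I) (u : I → A → (A → ℝ) → ℝ) (h : I → A → ℝ) : Prop :=
  ∀ᵐ i ∂lam, ∃ φ : ℕ → (A → ℝ) → Measure (A → ℝ),
    (∀ n, IsPerturbation (φ n)) ∧
    (∀ τ ∈ stdSimplex ℝ A, WeakTendstoDirac (fun n => φ n τ) τ) ∧
    ∀ n, ∀ μ ∈ stdSimplex ℝ A,
      ∑ a, μ a * payM (u i) a (φ n (socSum lam h)) ≤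
        ∑ a, h i a * payM (u i) a (φ n (socSum lam h))

/-- `ε`-robust perfect equilibrium with perturbed player space `Iε` and
perturbation function `φ`. -/
def IsEpsRPE (lam : Measure I) (u : I → A → (A → ℝ) → ℝ) (ε : ℝ)
    (h : I → A → ℝ) (Iε : Set I) (φ : (A → ℝ) → Measure (A → ℝ)) : Prop :=
  IsProfile lam h ∧
  (∀ᵐ i ∂lam, ∀ a : A, 0 < h i a) ∧
  MeasurableSet Iε ∧ ENNReal.ofReal (1 - ε) < lam Iε ∧
  IsPerturbation φ ∧
  (∀ τ ∈ stdSimplex ℝ A, ENNReal.ofReal (1 - ε) ≤ φ τ {τ}) ∧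
  ∀ i ∈ Iε, ∀ am al : A,
    payM (u i) am (φ (socSum lam h)) < payM (u i) al (φ (socSum lam h)) →
      h i am ≤ ε

/-- Robust perfect equilibrium. -/
def IsRPE (lam : Measure I) (u : I → A → (A → ℝ) → ℝ) (h : I → A → ℝ) : Prop :=
  IsProfile lam h ∧
  ∃ (ε : ℕ → ℝ) (hs : ℕ → I → A → ℝ) (Is : ℕ → Set I)
      (φs : ℕ → (A → ℝ) → Measure (A → ℝ)),
    (∀ n, 0 < ε n) ∧ Tendsto ε atTop (nhds 0) ∧
    (∀ n, IsEpsRPE lam u (ε n) (hs n) (Is n) (φs n)) ∧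
    (∀ᵐ i ∂lam, ∃ nk : ℕ → ℕ, StrictMono nk ∧ (∀ k, i ∈ Is (nk k)) ∧
      Tendsto (fun k => hs (nk k) i) atTop (nhds (h i))) ∧
    Tendsto (fun n => socSum lam (hs n)) atTop (nhds (socSum lam h))

/-- The Dirac randomized strategy profile induced by a pure strategy profile. -/
def diracProfile [DecidableEq A] (f : I → A) : I → A → ℝ :=
  fun i a => if a = f i then 1 else 0

end RobustPerfect

section Primitive

variable {X ι L : Type*} [LinearOrder L]

/-- A set `S` is undominated for the family of order keys `r` if every `y` lies weakly below all of
`S` in at least one of the orders. -/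
def Undominated (r : ι → X → L) (S : Finset X) : Prop :=
  ∀ y, ∃ i, ∀ x ∈ S, r i y ≤ r i x

lemma Undominated.mono {r : ι → X → L} {S T : Finset X} (hT : Undominated r T) (h : S ⊆ T) :
    Undominated r S := fun y => (hT y).imp fun _ hi x hx => hi x (h hx)

/-- A colored set with as many elements as there are colors, missing exactly the color `i₀`, has
exactly two elements whose removal leaves all colors but `i₀`. -/
lemma card_filter_image_erase_eq_two [DecidableEq X] [Fintype ι] [DecidableEq ι] (c : X → ι)
    {S : Finset X} {i₀ : ι}
    (hcard : S.card = Fintype.card ι) (hS : S.image c = Finset.univ.erase i₀) :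
    (S.filter fun x => (S.erase x).image c = Finset.univ.erase i₀).card = 2 := by
  have hK : 0 < Fintype.card ι := Fintype.card_pos_iff.2 ⟨i₀⟩
  have hcardE : (Finset.univ.erase i₀ : Finset ι).card + 1 = Fintype.card ι := by
    rw [Finset.card_erase_of_mem (Finset.mem_univ _), Finset.card_univ]
    omega
  have hninj : ¬ Set.InjOn c S := fun h => by
    have := Finset.card_image_of_injOn h
    rw [hS] at this
    omega
  obtain ⟨x, hx, y, hy, hxy, hne⟩ : ∃ x ∈ S, ∃ y ∈ S, c x = c y ∧ x ≠ y := by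
    simpa [Set.InjOn] using hninj
  have herase : ∀ x ∈ S, ∀ y ∈ S, c x = c y → x ≠ y →
      (S.erase y).image c = Finset.univ.erase i₀ := by
    intro x hx y hy hxy hne
    rw [← hS]
    ext k
    simp only [Finset.mem_image, Finset.mem_erase]
    refine ⟨fun ⟨z, hz, hk⟩ => ⟨z, hz.2, hk⟩, fun ⟨z, hz, hk⟩ => ?_⟩
    by_cases hzy : z = y
    · exact ⟨x, ⟨hne, hx⟩, by rw [hxy, ← hzy, hk]⟩
    · exact ⟨z, ⟨hzy, hz⟩, hk⟩
  have hinj : Set.InjOn c (S.erase y) := by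
    rw [← Finset.card_image_iff, herase x hx y hy hxy hne, Finset.card_erase_of_mem hy]
    omega
  refine Finset.card_eq_two.2 ⟨x, y, hne, ?_⟩
  ext z
  simp only [Finset.mem_filter, Finset.mem_insert, Finset.mem_singleton]
  constructor
  · rintro ⟨hz, hzi⟩
    by_contra! hzn
    have : c z ∈ (S.erase z).image c := by
      rw [hzi, ← hS]
      exact Finset.mem_image_of_mem _ hz
    obtain ⟨w, hw, hwz⟩ := Finset.mem_image.1 this
    obtain ⟨hwz', hwS⟩ := Finset.mem_erase.1 hw
    by_cases hwy : w = y
    · exact hzn.1 (hinj (by simpa using ⟨hz, hzn.2⟩) (by simpa using ⟨hx, hne⟩)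
        (by rw [← hwz, hwy, hxy]))
    · exact hwz' (hinj (by simpa using ⟨hwS, hwy⟩) (by simpa using ⟨hz, hzn.2⟩) hwz)
  · rintro (rfl | rfl)
    · exact ⟨hx, herase y hy z hx hxy.symm hne.symm⟩
    · exact ⟨hy, herase x hx z hy hxy hne⟩

/-- `x` is the largest element, in the order `k`, among those strictly above `m l` in every other
order `l`. -/
def IsPivot (r : ι → X → L) (m : ι → X) (k : ι) (x : X) : Prop :=
  (∀ l, l ≠ k → r l (m l) < r l x) ∧
    ∀ y, (∀ l, l ≠ k → r l (m l) < r l y) → r k y ≤ r k x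

lemma IsPivot.eq {r : ι → X → L} (hr : ∀ i, Function.Injective (r i)) {m : ι → X} {k : ι} {x y : X}
    (hx : IsPivot r m k x) (hy : IsPivot r m k y) : x = y :=
  hr k (le_antisymm (hy.2 _ hx.1) (hx.2 _ hy.1))

variable [Fintype X]

lemma exists_isPivot {r : ι → X → L} {m : ι → X} {k : ι} {z : X}
    (hz : ∀ l, l ≠ k → r l (m l) < r l z) : ∃ x, IsPivot r m k x := by
  classical
  obtain ⟨x, hx, hmax⟩ := Finset.exists_max_image
    (Finset.univ.filter fun y => ∀ l, l ≠ k → r l (m l) < r l y) (r k) ⟨z, by simpa using hz⟩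
  refine ⟨x, by simpa using hx, fun y hy => hmax y (by simpa using hy)⟩

variable [DecidableEq X]

open Classical in
/-- The elements whose addition to `S` keeps it undominated. -/
noncomputable def extenders (r : ι → X → L) (S : Finset X) : Finset X :=
  Finset.univ.filter fun x => x ∉ S ∧ Undominated r (insert x S)

lemma mem_extenders {r : ι → X → L} {S : Finset X} {x : X} :
    x ∈ extenders r S ↔ x ∉ S ∧ Undominated r (insert x S) := by
  simp [extenders]

variable [Fintype ι] [DecidableEq ι]

/-- An undominated set with one element fewer than there are orders has a unique pair of orders
sharing their minimizer, and its extenders are the pivots of these two orders. -/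
lemma exists_pair_extenders {r : ι → X → L} (hr : ∀ i, Function.Injective (r i)) {S : Finset X}
    (hS : Undominated r S) (hne : S.Nonempty) (hcard : S.card + 1 = Fintype.card ι) :
    ∃ (m : ι → X) (i j : ι), i ≠ j ∧ m i = m j ∧ (∀ k, m k ∈ S) ∧
      (∀ k, ∀ x ∈ S, r k (m k) ≤ r k x) ∧
      (∀ k l, m k = m l → k = l ∨ (k = i ∧ l = j) ∨ (k = j ∧ l = i)) ∧
      (∀ x, x ∈ extenders r S ↔ IsPivot r m i x ∨ IsPivot r m j x) ∧
      (∀ x, IsPivot r m i x → ¬ IsPivot r m j x) := by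
  choose m hmS hmin using fun k => S.exists_min_image (r k) hne
  have hsurj : ∀ x ∈ S, ∃ k, m k = x := fun x hx => by
    obtain ⟨k, hk⟩ := hS x
    exact ⟨k, hr k (le_antisymm (hmin k x hx) (hk _ (hmS k)))⟩
  have himg : Finset.univ.image m = S := by
    ext x
    simp only [Finset.mem_image, Finset.mem_univ, true_and]
    exact ⟨fun ⟨k, hk⟩ => hk ▸ hmS k, hsurj x⟩
  have hninj : ¬ Function.Injective m := fun h => by
    have := Finset.card_image_of_injective Finset.univ h
    rw [himg, Finset.card_univ] at this
    omega
  obtain ⟨i, j, hij, hne'⟩ : ∃ i j, m i = m j ∧ i ≠ j := by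
    simpa [Function.Injective] using hninj
  have himg' : (Finset.univ.erase j).image m = S := by
    ext x
    simp only [Finset.mem_image, Finset.mem_erase, Finset.mem_univ, and_true]
    refine ⟨fun ⟨k, _, hk⟩ => hk ▸ hmS k, fun hx => ?_⟩
    obtain ⟨k, rfl⟩ := hsurj x hx
    by_cases hk : k = j
    · exact ⟨i, hne', hk ▸ hij⟩
    · exact ⟨k, hk, rfl⟩
  have hinj : Set.InjOn m (Finset.univ.erase j : Finset ι) := by
    rw [← Finset.card_image_iff, himg', Finset.card_erase_of_mem (Finset.mem_univ _),
      Finset.card_univ]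
    omega
  have hpair : ∀ k l, m k = m l → k = l ∨ (k = i ∧ l = j) ∨ (k = j ∧ l = i) := by
    intro k l hkl
    by_cases hk : k = j <;> by_cases hl : l = j
    · exact .inl (hk.trans hl.symm)
    · exact .inr (.inr ⟨hk, hinj (by simpa using hl) (by simpa using hne')
        (by rw [← hkl, hk, hij])⟩)
    · exact .inr (.inl ⟨hinj (by simpa using hk) (by simpa using hne') (by rw [hkl, hl, hij]), hl⟩)
    · exact .inl (hinj (by simpa using hk) (by simpa using hl) hkl)
  have hnot_all : ∀ x, ¬ ∀ l, r l (m l) < r l x := fun x h => by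
    obtain ⟨l, hl⟩ := hS x
    exact absurd (hl _ (hmS l)) (not_le.2 (h l))
  have hback : ∀ k k', k ≠ k' → m k = m k' → ∀ x, IsPivot r m k x → x ∈ extenders r S := by
    intro k k' hkk' hmk x hx
    rw [mem_extenders]
    constructor
    · intro hxS
      obtain ⟨l, rfl⟩ := hsurj x hxS
      by_cases hl : l = k
      · subst hl
        have := hx.1 k' hkk'.symm
        rw [hmk] at this
        exact lt_irrefl _ this
      · exact lt_irrefl _ (hx.1 l hl)
    · intro y
      by_cases hy : ∀ l, l ≠ k → r l (m l) < r l y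
      · obtain ⟨l, hl⟩ := hS y
        have hlk : l = k := by
          by_contra hlk
          exact absurd (hl _ (hmS l)) (not_le.2 (hy l hlk))
        subst hlk
        exact ⟨l, by simpa using ⟨hx.2 y hy, hl⟩⟩
      · push Not at hy
        obtain ⟨l, hlk, hl⟩ := hy
        exact ⟨l, by simpa using ⟨hl.trans (hx.1 l hlk).le, fun z hz => hl.trans (hmin l z hz)⟩⟩
  refine ⟨m, i, j, hne', hij, hmS, hmin, hpair, fun x => ⟨fun hx => ?_, ?_⟩, fun x hi hj => ?_⟩
  · rw [mem_extenders] at hx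
    obtain ⟨hxS, hdom⟩ := hx
    obtain ⟨k, hk⟩ := hdom x
    have hkx : r k x < r k (m k) :=
      lt_of_le_of_ne (hk _ (Finset.mem_insert_of_mem (hmS k)))
        fun h => hxS (hr k h ▸ hmS k)
    have hmk : ∀ l, ∃ l', l' ≠ k ∧ m l = m l' ∧ r l' (m l) ≤ r l' x := by
      intro l
      obtain ⟨l', hl'⟩ := hdom (m l)
      have he : m l = m l' := hr l' (le_antisymm
        (hl' _ (Finset.mem_insert_of_mem (hmS l'))) (hmin _ _ (hmS l)))
      refine ⟨l', ?_, he, hl' _ (Finset.mem_insert_self _ _)⟩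
      rintro rfl
      exact absurd (hl' _ (Finset.mem_insert_self _ _)) (not_le.2 (he ▸ hkx))
    have hkij : k = i ∨ k = j := by
      obtain ⟨l', h1, h2, -⟩ := hmk k
      rcases hpair _ _ h2 with h | h | h
      · exact absurd h.symm h1
      · exact .inl h.1
      · exact .inr h.1
    have hpiv : IsPivot r m k x := by
      refine ⟨fun l hl => ?_, fun y hy => ?_⟩
      · obtain ⟨l', h1, h2, h3⟩ := hmk l
        have hll' : l = l' := by
          rcases hpair _ _ h2 with h | ⟨rfl, rfl⟩ | ⟨rfl, rfl⟩
          · exact h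
          · rcases hkij with h | h
            · exact absurd h.symm hl
            · exact absurd h.symm h1
          · rcases hkij with h | h
            · exact absurd h.symm h1
            · exact absurd h.symm hl
        subst hll'
        exact lt_of_le_of_ne h3 fun h => hxS (hr l h ▸ hmS l)
      · obtain ⟨l, hl⟩ := hdom y
        by_cases hlk : l = k
        · exact hlk ▸ hl _ (Finset.mem_insert_self _ _)
        · exact absurd (hl _ (Finset.mem_insert_of_mem (hmS l))) (not_le.2 (hy l hlk))
    rcases hkij with rfl | rfl
    · exact .inl hpiv
    · exact .inr hpiv
  · rintro (h | h)
    · exact hback i j hne' hij x h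
    · exact hback j i hne'.symm hij.symm x h
  · refine hnot_all x fun l => ?_
    by_cases hl : l = i
    · exact hj.1 l (hl ▸ hne')
    · exact hi.1 l hl

/-- If `S` contains an element which is not a slack element, it has exactly two extenders. -/
lemma card_extenders_of_not_subset_range {r : ι → X → L} (hr : ∀ i, Function.Injective (r i))
    {s : ι → X} (hs : ∀ i j y, i ≠ j → y ∉ Set.range s → r i y < r i (s j)) {S : Finset X}
    (hS : Undominated r S) (hcard : S.card + 1 = Fintype.card ι) {t : X} (ht : t ∈ S)
    (hts : t ∉ Set.range s) : (extenders r S).card = 2 := by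
  obtain ⟨m, i, j, -, -, -, hmin, -, hext, hdisj⟩ := exists_pair_extenders hr hS ⟨t, ht⟩ hcard
  have hpiv : ∀ k, ∃ x, IsPivot r m k x := fun k => exists_isPivot (z := s k)
    fun l hl => (hmin l t ht).trans_lt (hs l k t hl hts)
  obtain ⟨x, hx⟩ := hpiv i
  obtain ⟨y, hy⟩ := hpiv j
  rw [Finset.card_eq_two]
  refine ⟨x, y, fun h => hdisj x hx (h ▸ hy), ?_⟩
  ext z
  rw [hext, Finset.mem_insert, Finset.mem_singleton]
  refine or_congr ⟨fun h => h.eq hr hx, fun h => h ▸ hx⟩ ⟨fun h => h.eq hr hy, fun h => h ▸ hy⟩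

/-- The set of all slack elements but one has exactly one extender. -/
lemma card_extenders_slack {r : ι → X → L} (hr : ∀ i, Function.Injective (r i))
    {s : ι → X} (hsinj : Function.Injective s) (hbot : ∀ i y, r i (s i) ≤ r i y)
    (hs : ∀ i j y, i ≠ j → y ∉ Set.range s → r i y < r i (s j)) (i₀ : ι)
    (hι : 2 ≤ Fintype.card ι) :
    (extenders r ((Finset.univ.erase i₀).image s)).card = 1 := by
  set S := (Finset.univ.erase i₀).image s with hSdef
  have hmem : ∀ l, l ≠ i₀ → s l ∈ S := fun l hl => Finset.mem_image_of_mem _ (by simpa using hl)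
  have hcard : S.card + 1 = Fintype.card ι := by
    rw [hSdef, Finset.card_image_of_injective _ hsinj,
      Finset.card_erase_of_mem (Finset.mem_univ _), Finset.card_univ]
    omega
  have hne : S.Nonempty := Finset.card_pos.1 (by omega)
  have hblt : ∀ l z, z ≠ s l → r l (s l) < r l z := fun l z hz =>
    lt_of_le_of_ne (hbot l z) fun h => hz (hr l h).symm
  have hS : Undominated r S := by
    intro y
    by_cases hy : ∃ l, l ≠ i₀ ∧ y = s l
    · obtain ⟨l, -, rfl⟩ := hy
      exact ⟨l, fun x _ => hbot l x⟩
    · by_cases hy' : y = s i₀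
      · exact ⟨i₀, fun x _ => hy' ▸ hbot i₀ x⟩
      · refine ⟨i₀, fun x hx => ?_⟩
        obtain ⟨l, hl, rfl⟩ := Finset.mem_image.1 hx
        refine (hs i₀ l y (Finset.ne_of_mem_erase hl).symm ?_).le
        rintro ⟨k, rfl⟩
        by_cases hk : k = i₀
        · exact hy' (hk ▸ rfl)
        · exact hy ⟨k, hk, rfl⟩
  obtain ⟨m, i, j, hij, hmij, hmS, hmin, hpair, hext, hdisj⟩ := exists_pair_extenders hr hS hne hcard
  have hm : ∀ l, l ≠ i₀ → m l = s l := fun l hl =>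
    hr l (le_antisymm (hmin l _ (hmem l hl)) (hbot l _))
  have hpiv : ∃ x, IsPivot r m i₀ x := exists_isPivot (z := s i₀) fun l hl => by
    rw [hm l hl]
    exact hblt l _ fun h => hl (hsinj h).symm
  have hnpiv : ∀ k, k ≠ i₀ → m k = m i₀ → ∀ y, ¬ IsPivot r m k y := by
    rintro k hk hmk y ⟨hy, -⟩
    have h0 := hy i₀ hk.symm
    rw [← hmk, hm k hk] at h0
    by_cases hyr : y ∈ Set.range s
    · obtain ⟨p, rfl⟩ := hyr
      by_cases hp : p = i₀
      · exact absurd (hbot i₀ (s k)) (not_le.2 (hp ▸ h0))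
      · by_cases hpk : p = k
        · exact lt_irrefl _ (hpk ▸ h0)
        · have := hy p hpk
          rw [hm p hp] at this
          exact lt_irrefl _ this
    · exact lt_asymm h0 (hs i₀ k y hk.symm hyr)
  have hone : ∀ k, k ≠ i₀ → m k = m i₀ →
      (∀ z, z ∈ extenders r S ↔ IsPivot r m i₀ z ∨ IsPivot r m k z) →
      (extenders r S).card = 1 := by
    intro k hk hmk hext
    obtain ⟨x, hx⟩ := hpiv
    refine Finset.card_eq_one.2 ⟨x, ?_⟩
    ext z
    rw [hext, Finset.mem_singleton]
    exact ⟨fun h => h.elim (fun h => h.eq hr hx) fun h => absurd h (hnpiv k hk hmk z),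
      fun h => .inl (h ▸ hx)⟩
  by_cases hi : i = i₀
  · subst hi
    exact hone j hij.symm hmij.symm hext
  · by_cases hj : j = i₀
    · subst hj
      exact hone i hi hmij fun z => (hext z).trans or_comm
    · exact absurd (hsinj ((hm i hi).symm.trans (hmij.trans (hm j hj)))) hij

open Classical in
/-- **Scarf's lemma** on primitive sets: for any coloring extending the tautological coloring of the
slack elements `s i`, some undominated set carries every color exactly once. -/
theorem exists_undominated_image_eq_univ {r : ι → X → L} (hr : ∀ i, Function.Injective (r i))
    {s : ι → X} (hbot : ∀ i y, r i (s i) ≤ r i y)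
    (hs : ∀ i j y, i ≠ j → y ∉ Set.range s → r i y < r i (s j)) (c : X → ι)
    (hc : ∀ i, c (s i) = i) (hι : 2 ≤ Fintype.card ι) :
    ∃ S : Finset X, Undominated r S ∧ S.card = Fintype.card ι ∧ S.image c = Finset.univ := by
  by_contra! hcon
  obtain ⟨i₀⟩ : Nonempty ι := Fintype.card_pos_iff.1 (by omega)
  have hsinj : Function.Injective s := Function.LeftInverse.injective hc
  set E : Finset ι := Finset.univ.erase i₀ with hE
  have hEcard : E.card + 1 = Fintype.card ι := by
    rw [hE, Finset.card_erase_of_mem (Finset.mem_univ _), Finset.card_univ]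
    omega
  set doors : Finset (Finset X) := Finset.univ.filter fun S =>
    Undominated r S ∧ S.card + 1 = Fintype.card ι ∧ S.image c = E with hdoors
  set rooms : Finset (Finset X) := Finset.univ.filter fun S =>
    Undominated r S ∧ S.card = Fintype.card ι ∧ S.image c = E with hrooms
  have hcount : ∑ S ∈ doors, (extenders r S).card =
      ∑ S ∈ rooms, (S.filter fun x => (S.erase x).image c = E).card := by
    rw [← Finset.card_sigma, ← Finset.card_sigma]
    refine Finset.card_bij' (fun p _ => ⟨insert p.2 p.1, p.2⟩) (fun p _ => ⟨p.1.erase p.2, p.2⟩)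
      ?_ ?_ ?_ ?_
    · rintro ⟨S, x⟩ h
      simp only [Finset.mem_sigma, mem_extenders, hdoors, hrooms, Finset.mem_filter,
        Finset.mem_univ, true_and] at h ⊢
      obtain ⟨⟨hS, hcard, himg⟩, hx, hdom⟩ := h
      have hcard' : (insert x S).card = Fintype.card ι := by
        rw [Finset.card_insert_of_notMem hx, hcard]
      refine ⟨⟨hdom, hcard', ?_⟩, Finset.mem_insert_self _ _, ?_⟩
      · have hne := hcon _ hdom hcard'
        rw [Finset.image_insert, himg] at hne ⊢
        refine Finset.insert_eq_of_mem ?_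
        by_contra hcx
        refine hne (Finset.eq_univ_iff_forall.2 fun k => ?_)
        have hcx' : c x = i₀ := by simpa [hE] using hcx
        by_cases hk : k = i₀
        · simp [hk, hcx']
        · simp [hE, hk]
      · rw [Finset.erase_insert hx, himg]
    · rintro ⟨S, x⟩ h
      simp only [Finset.mem_sigma, mem_extenders, hdoors, hrooms, Finset.mem_filter,
        Finset.mem_univ, true_and] at h ⊢
      obtain ⟨⟨hS, hcard, himg⟩, hx, hdom⟩ := h
      refine ⟨⟨hS.mono (Finset.erase_subset _ _), ?_, hdom⟩, Finset.notMem_erase _ _, ?_⟩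
      · rw [Finset.card_erase_add_one hx, hcard]
      · rwa [Finset.insert_erase hx]
    · rintro ⟨S, x⟩ h
      simp only [Finset.mem_sigma, mem_extenders] at h
      simp [Finset.erase_insert h.2.1]
    · rintro ⟨S, x⟩ h
      simp only [Finset.mem_sigma, Finset.mem_filter] at h
      simp [Finset.insert_erase h.2.1]
  have hrooms_even : Even (∑ S ∈ rooms, (S.filter fun x => (S.erase x).image c = E).card) := by
    refine Finset.even_sum _ fun S hS => ?_
    simp only [hrooms, Finset.mem_filter, Finset.mem_univ, true_and] at hS
    rw [card_filter_image_erase_eq_two c hS.2.1 hS.2.2]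
    exact even_two
  have hslack : ∀ S ∈ doors, (∀ x ∈ S, x ∈ Set.range s) → S = E.image s := by
    intro S hS hsub
    simp only [hdoors, Finset.mem_filter, Finset.mem_univ, true_and] at hS
    ext x
    rw [← hS.2.2]
    simp only [Finset.mem_image, exists_exists_and_eq_and]
    constructor
    · intro hx
      obtain ⟨k, rfl⟩ := hsub x hx
      exact ⟨s k, hx, by rw [hc]⟩
    · rintro ⟨y, hy, rfl⟩
      obtain ⟨k, rfl⟩ := hsub y hy
      rwa [hc]
  have hone : (extenders r (E.image s)).card = 1 :=
    card_extenders_slack hr hsinj hbot hs i₀ hι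
  have hdoor₀ : E.image s ∈ doors := by
    obtain ⟨x, hx⟩ := Finset.card_pos.1 (by omega : 0 < (extenders r (E.image s)).card)
    simp only [hdoors, Finset.mem_filter, Finset.mem_univ, true_and]
    refine ⟨(mem_extenders.1 hx).2.mono (Finset.subset_insert _ _), ?_, ?_⟩
    · rwa [Finset.card_image_of_injective _ hsinj]
    · ext k
      simp [hc]
  have hdoors_odd : Odd (∑ S ∈ doors, (extenders r S).card) := by
    rw [← Finset.add_sum_erase _ _ hdoor₀, hone, add_comm]
    refine Even.add_one (Finset.even_sum _ fun S hS => ?_)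
    obtain ⟨hne, hS⟩ := Finset.mem_erase.1 hS
    obtain ⟨t, ht, hts⟩ : ∃ t ∈ S, t ∉ Set.range s := by
      by_contra! h
      exact hne (hslack S hS h)
    simp only [hdoors, Finset.mem_filter, Finset.mem_univ, true_and] at hS
    rw [card_extenders_of_not_subset_range hr hs hS.1 hS.2.1 ht hts]
    exact even_two
  rw [hcount] at hdoors_odd
  exact Nat.not_even_iff_odd.2 hdoors_odd hrooms_even

end Primitive

section Nash

variable {A : Type*} [Fintype A]

/-- If no point of an `η`-net of the simplex exceeds all the points `p a`, `a ∈ C`, in every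
coordinate of `C`, then these points are close to each other and to the face spanned by `C`. -/
lemma exists_lower_corner {η : ℝ} {T : Set (A → ℝ)}
    (hT : ∀ z ∈ stdSimplex ℝ A, ∃ y ∈ T, dist z y < η) {C : Finset A} (hC : C.Nonempty)
    {p : A → A → ℝ} (hp : ∀ a ∈ C, p a ∈ stdSimplex ℝ A)
    (hdom : ∀ y ∈ T, ∃ i ∈ C, ∀ a ∈ C, y i ≤ p a i) :
    ∃ m : A → ℝ, ∀ a ∈ C, ∀ i, m i ≤ p a i ∧ p a i ≤ m i + Fintype.card A * η ∧
      (i ∉ C → m i = 0) := by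
  classical
  set m : A → ℝ := fun i => if i ∈ C then C.inf' hC fun a => p a i else 0 with hm
  have hmle : ∀ a ∈ C, ∀ i, m i ≤ p a i := by
    intro a ha i
    by_cases hi : i ∈ C
    · simpa [hm, hi] using ⟨a, ha, le_rfl⟩
    · simpa [hm, hi] using (hp a ha).1 i
  have hm0 : ∀ i, 0 ≤ m i := by
    intro i
    by_cases hi : i ∈ C
    · simpa [hm, hi] using fun a ha => (hp a ha).1 i
    · simp [hm, hi]
  have ⟨a₀, ha₀⟩ := hC
  have hCpos : (0 : ℝ) < C.card := by exact_mod_cast Finset.card_pos.2 ⟨a₀, ha₀⟩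
  have hsum : ∑ i, m i ≤ 1 := (hp a₀ ha₀).2 ▸ Finset.sum_le_sum fun i _ => hmle a₀ ha₀ i
  set s : ℝ := (1 - ∑ i, m i) / C.card with hs
  have hs0 : 0 ≤ s := div_nonneg (by linarith) hCpos.le
  have hz : (fun i => m i + if i ∈ C then s else 0) ∈ stdSimplex ℝ A := by
    refine ⟨fun i => add_nonneg (hm0 i) (by split_ifs <;> simp [hs0]), ?_⟩
    have h1 : ∑ i, (if i ∈ C then s else 0) = C.card * s := by simp
    rw [Finset.sum_add_distrib, h1, hs, mul_div_cancel₀ _ hCpos.ne', add_sub_cancel]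
  obtain ⟨y, hyT, hy⟩ := hT _ hz
  obtain ⟨i, hi, hyi⟩ := hdom y hyT
  have hym : y i ≤ m i := by
    simp only [hm, hi, if_true]
    exact Finset.le_inf' _ _ hyi
  have hsη : s < η := by
    have h1 := (dist_le_pi_dist _ y i).trans_lt hy
    simp only [hi, if_true, Real.dist_eq] at h1
    linarith [(abs_lt.1 h1).2]
  have hgap : 1 - ∑ i, m i ≤ Fintype.card A * η := by
    have h1 : 1 - ∑ i, m i = C.card * s := by rw [hs]; field_simp
    rw [h1]
    have h2 : (C.card : ℝ) ≤ Fintype.card A := by exact_mod_cast C.card_le_univ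
    exact mul_le_mul h2 hsη.le hs0 (Nat.cast_nonneg _)
  refine ⟨m, fun a ha k => ⟨hmle a ha k, ?_, fun hk => by simp [hm, hk]⟩⟩
  have h1 : p a k - m k ≤ ∑ i, (p a i - m i) :=
    Finset.single_le_sum (f := fun i => p a i - m i)
      (fun i _ => sub_nonneg.2 (hmle a ha i)) (Finset.mem_univ k)
  rw [Finset.sum_sub_distrib, (hp a ha).2] at h1
  linarith

/-- Order keys on a finite set of points of the simplex augmented by slack elements. -/
noncomputable def simplexKey [DecidableEq A] {T : Finset (A → ℝ)} (i : A) (x : T ⊕ A) :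
    ℝ ×ₗ Fin (Fintype.card (T ⊕ A)) :=
  toLex (Sum.elim (fun t => t.1 i) (fun j => if j = i then -1 else 2) x, Fintype.equivFin _ x)

/-- A combinatorial fixed point lemma: for every coloring of the simplex by its coordinates there
is a point that is close to points of each color on which it has a non-negligible coordinate. -/
lemma exists_near_color [Nontrivial A] (c : (A → ℝ) → A) {ε : ℝ} (hε : 0 < ε) :
    ∃ z ∈ stdSimplex ℝ A, ∀ a, z a ≤ ε ∨ ∃ p ∈ stdSimplex ℝ A, c p = a ∧ dist p z ≤ ε := by
  classical
  have hK : (0 : ℝ) < Fintype.card A := by exact_mod_cast Fintype.card_pos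
  set η : ℝ := ε / Fintype.card A with hη
  have hη0 : 0 < η := by positivity
  have hKη : Fintype.card A * η = ε := by rw [hη]; field_simp
  obtain ⟨t, htΔ, htfin, htcov⟩ := (isCompact_stdSimplex ℝ A).finite_cover_balls hη0
  lift t to Finset (A → ℝ) using htfin
  have hnet : ∀ z ∈ stdSimplex ℝ A, ∃ y ∈ (t : Set (A → ℝ)), dist z y < η := fun z hz => by
    simpa using htcov hz
  have hlt : ∀ (i : A) (x y : t ⊕ A),
      Sum.elim (fun t => t.1 i) (fun j => if j = i then -1 else 2) x <
        Sum.elim (fun t => t.1 i) (fun j => if j = i then (-1 : ℝ) else 2) y →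
      simplexKey i x < simplexKey i y := fun i x y h => Prod.Lex.toLex_lt_toLex.2 (.inl h)
  have hle : ∀ (i : A) (x y : t), simplexKey i (.inl x : t ⊕ A) ≤ simplexKey i (.inl y) →
      x.1 i ≤ y.1 i := fun i x y h => by
    by_contra! hlt'
    exact absurd (hlt i (.inl y) (.inl x) hlt') (not_lt.2 h)
  have hbot : ∀ (i : A) (x : t), simplexKey i (.inr i : t ⊕ A) < simplexKey i (.inl x) :=
    fun i x => hlt i _ _ (by simpa using lt_of_lt_of_le (by norm_num) ((htΔ x.2).1 i))
  obtain ⟨S, hS, -, hSc⟩ := exists_undominated_image_eq_univ (r := simplexKey (T := t)) (s := Sum.inr)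
    (fun i x y h => (Fintype.equivFin _).injective (congrArg (fun q => (ofLex q).2) h))
    (fun i y => by
      rcases y with y | j
      · exact (hbot i y).le
      · by_cases hj : j = i
        · rw [hj]
        · exact (hlt i _ _ (by simpa [hj] using by norm_num)).le)
    (fun i j y hij hy => by
      rcases y with y | k
      · refine hlt i _ _ ?_
        have := (mem_Icc_of_mem_stdSimplex (htΔ y.2) i).2
        simp only [Sum.elim_inl, Sum.elim_inr, hij.symm, if_false]
        linarith
      · exact absurd ⟨k, rfl⟩ hy)
    (Sum.elim (fun x => c x.1) id) (fun _ => rfl) Fintype.one_lt_card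
  set C : Finset A := Finset.univ.filter fun a => (Sum.inr a : t ⊕ A) ∉ S with hC
  have hcol : ∀ a, ∃ p : A → ℝ, a ∈ C → ∃ h : p ∈ t, Sum.inl ⟨p, h⟩ ∈ S ∧ c p = a := by
    intro a
    by_cases ha : a ∈ C
    · have : a ∈ S.image (Sum.elim (fun x => c x.1) id) := hSc ▸ Finset.mem_univ a
      obtain ⟨x | b, hx, hxa⟩ := Finset.mem_image.1 this
      · exact ⟨x.1, fun _ => ⟨x.2, hx, hxa⟩⟩
      · obtain rfl : b = a := hxa
        exact absurd hx (by simpa [hC] using ha)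
    · exact ⟨0, fun h => absurd h ha⟩
  choose p hp using hcol
  have hpΔ : ∀ a ∈ C, p a ∈ stdSimplex ℝ A := fun a ha => htΔ (hp a ha).1
  have hdom : ∀ y ∈ (t : Set (A → ℝ)), ∃ i ∈ C, ∀ a ∈ C, y i ≤ p a i := by
    intro y hy
    obtain ⟨i, hi⟩ := hS (.inl ⟨y, hy⟩)
    refine ⟨i, ?_, fun a ha => ?_⟩
    · simp only [hC, Finset.mem_filter, Finset.mem_univ, true_and]
      exact fun h => absurd (hi _ h) (not_le.2 (hbot i _))
    · obtain ⟨h, hmem, -⟩ := hp a ha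
      exact hle i _ _ (hi _ hmem)
  have hCne : C.Nonempty := by
    obtain ⟨y, hy, -⟩ := hnet _ (single_mem_stdSimplex ℝ (Classical.arbitrary A))
    obtain ⟨i, hi, -⟩ := hdom y hy
    exact ⟨i, hi⟩
  obtain ⟨m, hm⟩ := exists_lower_corner hnet hCne hpΔ hdom
  rw [hKη] at hm
  obtain ⟨a₀, ha₀⟩ := hCne
  refine ⟨p a₀, hpΔ a₀ ha₀, fun a => ?_⟩
  by_cases ha : a ∈ C
  · refine .inr ⟨p a, hpΔ a ha, (hp a ha).2.2, (dist_pi_le_iff hε.le).2 fun i => ?_⟩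
    rw [Real.dist_eq, abs_le]
    constructor <;> linarith [(hm a ha i).1, (hm a ha i).2.1, (hm a₀ ha₀ i).1, (hm a₀ ha₀ i).2.1]
  · left
    linarith [(hm a₀ ha₀ a).2.1, (hm a₀ ha₀ a).2.2 ha]

/-- Every continuous population game has a Nash equilibrium distribution. -/
theorem exists_population_equilibrium [Nonempty A] (w : A → (A → ℝ) → ℝ)
    (hw : ∀ a, ContinuousOn (w a) (stdSimplex ℝ A)) :
    ∃ x ∈ stdSimplex ℝ A, ∀ a, x a = 0 ∨ ∀ b, w b x ≤ w a x := by
  rcases subsingleton_or_nontrivial A with hA | hA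
  · obtain ⟨a₀⟩ := ‹Nonempty A›
    classical
    exact ⟨_, single_mem_stdSimplex ℝ a₀, fun a => .inr fun b => by rw [Subsingleton.elim a b]⟩
  choose c hc using fun x => Finite.exists_max fun a => w a x
  have hpos : ∀ n : ℕ, 0 < (1 : ℝ) / (n + 1) := fun n => by positivity
  choose z hzΔ hz using fun n => exists_near_color c (hpos n)
  obtain ⟨x, hx, ψ, hψ, hlim⟩ := (isCompact_stdSimplex ℝ A).tendsto_subseq hzΔ
  refine ⟨x, hx, fun a => or_iff_not_imp_left.2 fun ha b => ?_⟩
  have hxa : 0 < x a := lt_of_le_of_ne (hx.1 a) (Ne.symm ha)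
  have hεlim : Tendsto (fun n => (1 : ℝ) / ((ψ n : ℕ) + 1)) atTop (𝓝 0) :=
    tendsto_one_div_add_atTop_nhds_zero_nat.comp hψ.tendsto_atTop
  have hev : ∀ᶠ n in atTop, ∃ p ∈ stdSimplex ℝ A, c p = a ∧
      dist p (z (ψ n)) ≤ (1 : ℝ) / ((ψ n : ℕ) + 1) := by
    filter_upwards [hεlim.eventually_lt (tendsto_pi_nhds.1 hlim a) hxa] with n hn
    exact (hz (ψ n) a).resolve_left (not_le.2 hn)
  obtain ⟨N, hN⟩ := eventually_atTop.1 hev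
  choose p hpΔ hpc hpd using fun n => hN (n + N) (Nat.le_add_left _ _)
  have hpx : Tendsto p atTop (𝓝[stdSimplex ℝ A] x) := by
    refine tendsto_nhdsWithin_iff.2 ⟨?_, Eventually.of_forall hpΔ⟩
    refine ((tendsto_add_atTop_iff_nat N).2 hlim).congr_dist ?_
    refine squeeze_zero (fun _ => dist_nonneg) (fun n => ?_) ((tendsto_add_atTop_iff_nat N).2 hεlim)
    rw [dist_comm]
    exact hpd n
  refine le_of_tendsto_of_tendsto' ((hw b x hx).tendsto.comp hpx) ((hw a x hx).tendsto.comp hpx)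
    fun n => ?_
  simpa [hpc n] using hc (p n) b

end Nash

section Atomless

variable {I : Type*} [MeasurableSpace I] {lam : Measure I} [IsFiniteMeasure lam]

lemma MeasAtomless.exists_real_lt (h : MeasAtomless lam) {s : Set I} (hs : MeasurableSet s)
    (hpos : 0 < lam.real s) {ε : ℝ} (hε : 0 < ε) :
    ∃ t, MeasurableSet t ∧ t ⊆ s ∧ 0 < lam.real t ∧ lam.real t < ε := by
  have hhalf : ∀ s, MeasurableSet s → 0 < lam.real s →
      ∃ t, MeasurableSet t ∧ t ⊆ s ∧ 0 < lam.real t ∧ lam.real t ≤ lam.real s / 2 := by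
    intro s hs hpos
    obtain ⟨t, ht, hts, h0, h1⟩ := h s hs (by simpa [measureReal_def, ENNReal.toReal_pos_iff] using
      (ENNReal.toReal_pos_iff.1 hpos).1)
    have h0' : 0 < lam.real t := ENNReal.toReal_pos h0.ne' (measure_ne_top _ _)
    have h1' : lam.real t < lam.real s :=
      (ENNReal.toReal_lt_toReal (measure_ne_top _ _) (measure_ne_top _ _)).2 h1
    have hdiff : lam.real (s \ t) = lam.real s - lam.real t := measureReal_sdiff hts ht
    rcases le_total (lam.real t) (lam.real s / 2) with hle | hle
    · exact ⟨t, ht, hts, h0', hle⟩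
    · exact ⟨s \ t, hs.diff ht, Set.sdiff_subset, by linarith, by linarith⟩
  have hpow : ∀ n : ℕ, ∃ t, MeasurableSet t ∧ t ⊆ s ∧ 0 < lam.real t ∧
      lam.real t ≤ lam.real s * (1 / 2) ^ n := by
    intro n
    induction n with
    | zero => exact ⟨s, hs, subset_rfl, hpos, by simp⟩
    | succ n ih =>
      obtain ⟨t, ht, hts, h0, h1⟩ := ih
      obtain ⟨t', ht', hts', h0', h1'⟩ := hhalf t ht h0
      refine ⟨t', ht', hts'.trans hts, h0', h1'.trans ?_⟩
      rw [pow_succ]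
      linarith
  obtain ⟨n, hn⟩ := exists_pow_lt_of_lt_one (div_pos hε hpos) (by norm_num : (1 / 2 : ℝ) < 1)
  obtain ⟨t, ht, hts, h0, h1⟩ := hpow n
  refine ⟨t, ht, hts, h0, h1.trans_lt ?_⟩
  rwa [lt_div_iff₀ hpos, mul_comm] at hn

/-- **Sierpiński's theorem**: an atomless finite measure takes every intermediate value. -/
theorem MeasAtomless.exists_subset_real_eq (h : MeasAtomless lam) {s : Set I} (hs : MeasurableSet s)
    {c : ℝ} (hc0 : 0 ≤ c) (hc : c ≤ lam.real s) :
    ∃ t, MeasurableSet t ∧ t ⊆ s ∧ lam.real t = c := by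
  set F : Set (Set I) := {t | MeasurableSet t ∧ t ⊆ s ∧ lam.real t ≤ c} with hF
  have hstep : ∀ u : F, ∃ v : F, u.1 ⊆ v.1 ∧
      ∀ w ∈ F, u.1 ⊆ w → lam.real w + lam.real u.1 ≤ 2 * lam.real v.1 := by
    rintro ⟨u, hu⟩
    set R : Set ℝ := {x | ∃ w ∈ F, u ⊆ w ∧ lam.real w = x} with hR
    have hbdd : BddAbove R := ⟨c, by rintro _ ⟨w, hw, -, rfl⟩; exact hw.2.2⟩
    have huR : lam.real u ∈ R := ⟨u, hu, subset_rfl, rfl⟩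
    have hle : ∀ w ∈ F, u ⊆ w → lam.real w ≤ sSup R := fun w hw huw =>
      le_csSup hbdd ⟨w, hw, huw, rfl⟩
    rcases (hle u hu subset_rfl).eq_or_lt with heq | hlt
    · exact ⟨⟨u, hu⟩, subset_rfl, fun w hw huw => by
        have := hle w hw huw
        simp only
        linarith⟩
    · obtain ⟨_, ⟨v, hv, huv, rfl⟩, hlt'⟩ :=
        exists_lt_of_lt_csSup ⟨_, huR⟩ (by linarith : (sSup R + lam.real u) / 2 < sSup R)
      exact ⟨⟨v, hv⟩, huv, fun w hw huw => by
        have := hle w hw huw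
        simp only
        linarith⟩
  choose g hgsub hg using hstep
  set U : ℕ → F := fun n => g^[n] ⟨∅, MeasurableSet.empty, Set.empty_subset _, by simpa using hc0⟩
    with hU
  have hUsucc : ∀ n, U (n + 1) = g (U n) := fun n => Function.iterate_succ_apply' g n _
  have hmono : Monotone fun n => (U n).1 :=
    monotone_nat_of_le_succ fun n => by rw [hUsucc]; exact hgsub (U n)
  set V : Set I := ⋃ n, (U n).1 with hV
  have hVm : MeasurableSet V := MeasurableSet.iUnion fun n => (U n).2.1
  have hVs : V ⊆ s := Set.iUnion_subset fun n => (U n).2.2.1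
  have hlim : Tendsto (fun n => lam.real (U n).1) atTop (𝓝 (lam.real V)) :=
    (ENNReal.tendsto_toReal (measure_ne_top _ _)).comp (tendsto_measure_iUnion_atTop hmono)
  have hVc : lam.real V ≤ c := le_of_tendsto' hlim fun n => (U n).2.2.2
  refine ⟨V, hVm, hVs, hVc.eq_of_not_lt fun hlt => ?_⟩
  have hdiff : lam.real (s \ V) = lam.real s - lam.real V := measureReal_sdiff hVs hVm
  obtain ⟨t, ht, hts, h0, h1⟩ := h.exists_real_lt (hs.diff hVm) (by linarith : 0 < lam.real (s \ V))
    (sub_pos.2 hlt)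
  have hun : lam.real (V ∪ t) = lam.real V + lam.real t :=
    measureReal_union (Set.disjoint_sdiff_right.mono_right hts) ht
  have hW : V ∪ t ∈ F :=
    ⟨hVm.union ht, Set.union_subset hVs (hts.trans Set.sdiff_subset), by linarith⟩
  have hineq : ∀ n, lam.real (V ∪ t) + lam.real (U n).1 ≤ 2 * lam.real (U (n + 1)).1 := fun n => by
    rw [hUsucc]
    exact hg (U n) _ hW ((Set.subset_iUnion (fun n => (U n).1) n).trans Set.subset_union_left)
  have := le_of_tendsto_of_tendsto' (hlim.const_add _)
    (((tendsto_add_atTop_iff_nat 1).2 hlim).const_mul 2) hineq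
  linarith

/-- On an atomless space there is a measurable map into a finite set with any prescribed
distribution, taking no value of probability zero. -/
lemma MeasAtomless.exists_measurable_real_preimage_eq {A : Type*} [MeasurableSpace A]
    [MeasurableSingletonClass A] (h : MeasAtomless lam) (p : A → ℝ) (hp : ∀ a, 0 ≤ p a)
    {B : Finset A} (hB : B.Nonempty) {s : Set I} (hs : MeasurableSet s)
    (hsum : ∑ a ∈ B, p a = lam.real s) :
    ∃ f : I → A, Measurable f ∧ (∀ i, f i ∈ B) ∧ ∀ a ∈ B, lam.real (s ∩ f ⁻¹' {a}) = p a := by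
  classical
  induction hB using Finset.Nonempty.cons_induction generalizing s with
  | singleton a =>
    refine ⟨fun _ => a, measurable_const, by simp, fun b hb => ?_⟩
    obtain rfl := Finset.mem_singleton.1 hb
    simpa using hsum.symm
  | cons a B ha hB ih =>
    rw [Finset.sum_cons] at hsum
    obtain ⟨t, ht, hts, hta⟩ := h.exists_subset_real_eq hs (hp a)
      (by linarith [Finset.sum_nonneg fun b (_ : b ∈ B) => hp b])
    obtain ⟨f, hf, hfB, hfp⟩ := ih (hs.diff ht)
      (by rw [measureReal_sdiff hts ht]; linarith)
    refine ⟨t.piecewise (fun _ => a) f, Measurable.piecewise ht measurable_const hf, fun i => ?_,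
      fun b hb => ?_⟩
    · by_cases hi : i ∈ t
      · simp [hi]
      · simp [hi, hfB i]
    · rcases Finset.mem_cons.1 hb with rfl | hb
      · rw [← hta]
        congr 1
        ext i
        by_cases hi : i ∈ t
        · simp [hi, hts hi]
        · have : f i ≠ b := fun h => ha (h ▸ hfB i)
          simp [hi, this]
      · rw [← hfp b hb]
        congr 1
        ext i
        by_cases hi : i ∈ t
        · have : a ≠ b := fun h => ha (h ▸ hb)
          simp [hi, this]
        · simp [hi]

end Atomless

section Perturbation

variable {A : Type*} [Fintype A]

lemma integrable_of_continuousOn_stdSimplex {η : Measure (A → ℝ)} [IsFiniteMeasure η]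
    (hη : η (stdSimplex ℝ A)ᶜ = 0) {g : (A → ℝ) → ℝ} (hg : ContinuousOn g (stdSimplex ℝ A)) :
    Integrable g η := by
  have h := hg.integrableOn_compact (μ := η) (isCompact_stdSimplex ℝ A)
  rwa [IntegrableOn, Measure.restrict_eq_self_of_ae_mem (s := stdSimplex ℝ A) (mem_ae_iff.2 hη)] at h

lemma exists_fullSupportOnSimplex (A : Type*) [Fintype A] [Nonempty A] :
    ∃ ν : Measure (A → ℝ), FullSupportOnSimplex ν := by
  set d : ℕ → A → ℝ := fun n => (TopologicalSpace.denseSeq (stdSimplex ℝ A) n : A → ℝ) with hd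
  have hdm : Measurable d := measurable_of_countable d
  have hne : NeZero (Measure.count : Measure ℕ) := ⟨by simp⟩
  refine ⟨Measure.map d (Measure.count : Measure ℕ).toFinite,
    Measure.isProbabilityMeasure_map hdm.aemeasurable, ?_, fun U hU hUne => ?_⟩
  · rw [Measure.map_apply hdm (isClosed_stdSimplex ℝ A).measurableSet.compl]
    have : d ⁻¹' (stdSimplex ℝ A)ᶜ = ∅ := Set.eq_empty_of_forall_notMem fun n hn =>
      hn (TopologicalSpace.denseSeq (stdSimplex ℝ A) n).2
    rw [this, measure_empty]
  · obtain ⟨x, hxU, hxΔ⟩ := hUne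
    obtain ⟨n, hn⟩ := (TopologicalSpace.denseRange_denseSeq (stdSimplex ℝ A)).exists_mem_open
      (hU.preimage continuous_subtype_val) ⟨⟨x, hxΔ⟩, hxU⟩
    rw [Measure.map_apply hdm hU.measurableSet]
    refine pos_iff_ne_zero.2 fun h0 => ?_
    have := absolutelyContinuous_toFinite (Measure.count : Measure ℕ) h0
    rw [Measure.count_eq_zero_iff] at this
    exact (this ▸ hn : n ∈ (∅ : Set ℕ))

/-- Mixing the point mass at `τ` with the fixed measure `ν` of weight `δ`. -/
noncomputable def mixDirac (δ : ℝ) (ν : Measure (A → ℝ)) (τ : A → ℝ) : Measure (A → ℝ) :=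
  ENNReal.ofReal (1 - δ) • Measure.dirac τ + ENNReal.ofReal δ • ν

lemma integral_mixDirac {δ : ℝ} (hδ : 0 ≤ δ) (hδ1 : δ ≤ 1) {ν : Measure (A → ℝ)}
    {g : (A → ℝ) → ℝ} (hg : Integrable g ν) (τ : A → ℝ) :
    ∫ x, g x ∂(mixDirac δ ν τ) = (1 - δ) * g τ + δ * ∫ x, g x ∂ν := by
  rw [mixDirac, integral_add_measure
    ((integrable_dirac (by simp)).smul_measure ENNReal.ofReal_ne_top)
    (hg.smul_measure ENNReal.ofReal_ne_top), integral_smul_measure, integral_smul_measure,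
    integral_dirac, ENNReal.toReal_ofReal hδ, ENNReal.toReal_ofReal (by linarith), smul_eq_mul,
    smul_eq_mul]

lemma isPerturbation_mixDirac {δ : ℝ} (hδ : 0 < δ) (hδ1 : δ ≤ 1) {ν : Measure (A → ℝ)}
    (hν : FullSupportOnSimplex ν) : IsPerturbation (mixDirac δ ν) := by
  obtain ⟨hprob, hsupp, hfull⟩ := hν
  refine ⟨fun τ hτ => ⟨⟨?_⟩, ?_, fun U hU hne => ?_⟩, fun f hf => ?_⟩
  · simp [mixDirac, ← ENNReal.ofReal_add (sub_nonneg.2 hδ1) hδ.le]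
  · simp [mixDirac, hsupp, hτ]
  · have := ENNReal.mul_pos (ENNReal.ofReal_pos.2 hδ).ne' (hfull U hU hne).ne'
    exact this.trans_le (by simp [mixDirac])
  · simp_rw [integral_mixDirac hδ.le hδ1
      (integrable_of_continuousOn_stdSimplex hsupp hf.continuousOn)]
    exact (hf.measurable.const_mul _).add_const _

lemma ofReal_le_mixDirac_singleton {δ ε : ℝ} (hδε : δ ≤ ε) (ν : Measure (A → ℝ)) (τ : A → ℝ) :
    ENNReal.ofReal (1 - ε) ≤ mixDirac δ ν τ {τ} := by
  have h : ENNReal.ofReal (1 - ε) ≤ ENNReal.ofReal (1 - δ) :=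
    ENNReal.ofReal_le_ofReal (by linarith)
  exact h.trans (by simp [mixDirac])

/-- Players with the same payoff differences on the simplex have the same payoff differences against
every finite measure on the simplex. -/
lemma payM_sub_payM_eq {ν : Measure (A → ℝ)} [IsFiniteMeasure ν] (hν : ν (stdSimplex ℝ A)ᶜ = 0)
    {v v' : A → (A → ℝ) → ℝ} (hv : ∀ a, ContinuousOn (v a) (stdSimplex ℝ A))
    (hv' : ∀ a, ContinuousOn (v' a) (stdSimplex ℝ A)) {a b : A}
    (h : ∀ τ ∈ stdSimplex ℝ A, v a τ - v b τ = v' a τ - v' b τ) :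
    payM v a ν - payM v b ν = payM v' a ν - payM v' b ν := by
  have hInt : ∀ {w : A → (A → ℝ) → ℝ}, (∀ a, ContinuousOn (w a) (stdSimplex ℝ A)) →
      ∀ a, Integrable (w a) ν := fun hw a => integrable_of_continuousOn_stdSimplex hν (hw a)
  simp only [payM]
  rw [← integral_sub (hInt hv a) (hInt hv b), ← integral_sub (hInt hv' a) (hInt hv' b)]
  refine integral_congr_ae ?_
  filter_upwards [mem_ae_iff.2 hν] with τ hτ using h τ hτ

end Perturbation

section Trembling

variable {A : Type*} [Fintype A] [Nonempty A]

/-- A population game has a completely mixed distribution in which every suboptimal action has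
weight at most `δ`. -/
lemma exists_completely_mixed (w : A → (A → ℝ) → ℝ) (hw : ∀ a, ContinuousOn (w a) (stdSimplex ℝ A))
    {δ : ℝ} (hδ : 0 < δ) (hδ1 : δ < 1) :
    ∃ τ ∈ stdSimplex ℝ A, (∀ a, 0 < τ a) ∧ ∀ a, (∃ b, w a τ < w b τ) → τ a ≤ δ := by
  have hK : (1 : ℝ) ≤ Fintype.card A := by exact_mod_cast Fintype.card_pos
  set κ : ℝ := δ / Fintype.card A with hκ
  have hκ0 : 0 < κ := by positivity
  have hκδ : κ ≤ δ := div_le_self hδ.le hK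
  set T : (A → ℝ) → A → ℝ := fun x a => (1 - δ) * x a + κ with hT
  have hTΔ : Set.MapsTo T (stdSimplex ℝ A) (stdSimplex ℝ A) := by
    intro x hx
    refine ⟨fun a => add_nonneg (mul_nonneg (by linarith) (hx.1 a)) hκ0.le, ?_⟩
    simp only [hT, Finset.sum_add_distrib, ← Finset.mul_sum, hx.2, Finset.sum_const,
      Finset.card_univ, nsmul_eq_mul, hκ]
    field_simp
    ring
  have hTc : Continuous T := by fun_prop
  obtain ⟨x, hx, hopt⟩ := exists_population_equilibrium (fun a y => w a (T y))
    fun a => (hw a).comp hTc.continuousOn hTΔ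
  refine ⟨T x, hTΔ hx, fun a => ?_, fun a ⟨b, hb⟩ => ?_⟩
  · have := mul_nonneg (sub_nonneg.2 hδ1.le) (hx.1 a)
    simp only [hT]
    linarith
  · have hxa : x a = 0 := (hopt a).resolve_right fun h => absurd (h b) (not_le.2 hb)
    simpa [hT, hxa] using hκδ

/-- Completely mixed near-equilibria of games perturbed by constant payoffs `q` accumulate at a
distribution that gives no weight to the actions suboptimal in the perturbed games. -/
lemma exists_trembling_limit (P : A → (A → ℝ) → ℝ)
    (hP : ∀ a, ContinuousOn (P a) (stdSimplex ℝ A)) (q : A → ℝ) :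
    ∃ x ∈ stdSimplex ℝ A, ∀ ε > 0, ∃ δ, 0 < δ ∧ δ ≤ 1 ∧ δ ≤ ε ∧ ∃ τ ∈ stdSimplex ℝ A,
      dist τ x < ε ∧ (∀ a, (1 - ε) * x a < τ a) ∧
      ∀ a, (∃ b, (1 - δ) * P a τ + δ * q a < (1 - δ) * P b τ + δ * q b) → x a = 0 ∧ τ a ≤ ε := by
  have hδ0 : ∀ n : ℕ, 0 < (1 : ℝ) / ((n + 1 : ℕ) + 1) := fun n => by positivity
  have hδ1 : ∀ n : ℕ, (1 : ℝ) / ((n + 1 : ℕ) + 1) < 1 := fun n => by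
    rw [div_lt_one (by positivity)]
    push_cast
    linarith [Nat.cast_nonneg (α := ℝ) n]
  choose τ hτΔ hτpos hτ using fun n : ℕ => exists_completely_mixed
    (fun a y => (1 - 1 / ((n + 1 : ℕ) + 1)) * P a y + 1 / ((n + 1 : ℕ) + 1) * q a)
    (fun a => ((hP a).const_mul _).add continuousOn_const) (hδ0 n) (hδ1 n)
  obtain ⟨x, hx, ψ, hψ, hlim⟩ := (isCompact_stdSimplex ℝ A).tendsto_subseq hτΔ
  have hδlim : Tendsto (fun n => (1 : ℝ) / ((ψ n + 1 : ℕ) + 1)) atTop (𝓝 0) :=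
    (tendsto_one_div_add_atTop_nhds_zero_nat (𝕜 := ℝ)).comp
      ((tendsto_add_atTop_nat 1).comp hψ.tendsto_atTop)
  have hcoord := tendsto_pi_nhds.1 hlim
  refine ⟨x, hx, fun ε hε => ?_⟩
  have h1 : ∀ᶠ n in atTop, ∀ a, (1 - ε) * x a < τ (ψ n) a := by
    refine eventually_all.2 fun a => ?_
    rcases (hx.1 a).eq_or_lt with h0 | h0
    · refine Eventually.of_forall fun n => ?_
      rw [← h0]
      simpa using hτpos (ψ n) a
    · exact (hcoord a).eventually_const_lt (by nlinarith)
  have h2 : ∀ᶠ n in atTop, ∀ a, 0 < x a → (1 : ℝ) / ((ψ n + 1 : ℕ) + 1) < τ (ψ n) a := by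
    refine eventually_all.2 fun a => ?_
    by_cases h0 : 0 < x a
    · filter_upwards [hδlim.eventually_lt (hcoord a) h0] with n hn _ using hn
    · exact Eventually.of_forall fun n h => absurd h h0
  obtain ⟨n, hn1, hn2, hn3, hn4⟩ := (h1.and (h2.and ((hδlim.eventually_lt_const hε).and
    (Metric.tendsto_nhds.1 hlim ε hε)))).exists
  refine ⟨_, hδ0 (ψ n), (hδ1 (ψ n)).le, hn3.le, τ (ψ n), hτΔ _, hn4, hn1, fun a ha => ?_⟩
  have hle := hτ (ψ n) a ha
  refine ⟨le_antisymm (not_lt.1 fun h0 => ?_) (hx.1 a), hle.trans hn3.le⟩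
  exact absurd (hn2 a h0) (not_lt.2 hle)

end Trembling

section PotentialGame

variable {I A : Type*} [DecidableEq A]

/-- The profile obtained from the pure profile `f` with aggregate `x` by trembling so that the
aggregate becomes `τ`. -/
def trembleProfile (f : I → A) (x τ : A → ℝ) (ε : ℝ) : I → A → ℝ :=
  fun i a => τ a + (1 - ε) * (diracProfile f i a - x a)

lemma tendsto_trembleProfile (f : I → A) {x : A → ℝ} {τ : ℕ → A → ℝ} {ε : ℕ → ℝ}
    (hτ : Tendsto τ atTop (𝓝 x)) (hε : Tendsto ε atTop (𝓝 0)) (i : I) :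
    Tendsto (fun n => trembleProfile f x (τ n) (ε n) i) atTop (𝓝 (diracProfile f i)) := by
  refine tendsto_pi_nhds.2 fun a => ?_
  have h := (tendsto_pi_nhds.1 hτ a).add ((hε.const_sub 1).mul_const (diracProfile f i a - x a))
  simpa [trembleProfile] using h

variable [Fintype A]

lemma diracProfile_mem_stdSimplex (f : I → A) (i : I) : diracProfile f i ∈ stdSimplex ℝ A := by
  refine ⟨fun a => ?_, by simp [diracProfile]⟩
  simp only [diracProfile]
  split_ifs <;> norm_num

variable [MeasurableSpace I] [MeasurableSpace A] [MeasurableSingletonClass A]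

lemma measurable_diracProfile {f : I → A} (hf : Measurable f) : Measurable (diracProfile f) := by
  refine measurable_pi_lambda _ fun a => ?_
  exact Measurable.ite (measurableSet_eq_fun measurable_const hf) measurable_const measurable_const

lemma integrable_diracProfile (lam : Measure I) [IsFiniteMeasure lam] {f : I → A}
    (hf : Measurable f) (a : A) : Integrable (fun i => diracProfile f i a) lam := by
  refine Integrable.of_bound ((measurable_pi_apply a).comp
    (measurable_diracProfile hf)).aestronglyMeasurable 1 (Eventually.of_forall fun i => ?_)
  simp only [diracProfile]
  split_ifs <;> norm_num

lemma socSum_diracProfile (lam : Measure I) {f : I → A} (hf : Measurable f) (a : A) :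
    socSum lam (diracProfile f) a = lam.real (f ⁻¹' {a}) := by
  have h : (fun i => diracProfile f i a) = (f ⁻¹' {a}).indicator 1 := by
    ext i
    by_cases h : f i = a <;> simp [diracProfile, eq_comm (a := a), h]
  rw [socSum, h, integral_indicator_one (hf (measurableSet_singleton a))]

lemma socSum_trembleProfile (lam : Measure I) [IsProbabilityMeasure lam] {f : I → A}
    (hf : Measurable f) {x : A → ℝ} (hx : socSum lam (diracProfile f) = x) (τ : A → ℝ) (ε : ℝ) :
    socSum lam (trembleProfile f x τ ε) = τ := by
  ext a
  have hxa : ∫ i, diracProfile f i a ∂lam = x a := congrFun hx a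
  have hInt := integrable_diracProfile lam hf a
  simp only [socSum, trembleProfile]
  have hInt' : Integrable (fun i => (1 - ε) * (diracProfile f i a - x a)) lam :=
    (hInt.sub (integrable_const _)).const_mul _
  rw [integral_add (integrable_const _) hInt', integral_const_mul, integral_sub hInt (integrable_const _), hxa]
  simp

lemma isProfile_trembleProfile (lam : Measure I) {f : I → A} (hf : Measurable f) {x τ : A → ℝ}
    {ε : ℝ} (hx : x ∈ stdSimplex ℝ A) (hτ : τ ∈ stdSimplex ℝ A)
    (hpos : ∀ i a, 0 < trembleProfile f x τ ε i a) :
    IsProfile lam (trembleProfile f x τ ε) := by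
  refine ⟨measurable_pi_lambda _ fun a => ?_, fun i => ⟨fun a => (hpos i a).le, ?_⟩⟩
  · exact ((((measurable_pi_apply a).comp (measurable_diracProfile hf)).sub_const _).const_mul
      _).const_add _
  · simp only [trembleProfile]
    rw [Finset.sum_add_distrib, ← Finset.mul_sum, Finset.sum_sub_distrib, hx.2, hτ.2,
      (diracProfile_mem_stdSimplex f i).2]
    ring

end PotentialGame

/-- Every large potential game possesses a pure strategy
robust perfect equilibrium. -/
theorem statement12 {I : Type*} [MeasurableSpace I]
    {A : Type*} [Fintype A] [Nonempty A] [DecidableEq A]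
    [MeasurableSpace A] [MeasurableSingletonClass A]
    (lam : Measure I) [IsProbabilityMeasure lam] (hatomless : MeasAtomless lam)
    (u : I → A → (A → ℝ) → ℝ) (hu : IsLargeGame u)
    (Pot : A → (A → ℝ) → ℝ)
    (hpot : ∀ᵐ i ∂lam, ∀ am al : A, ∀ τ ∈ stdSimplex ℝ A,
      u i am τ - u i al τ = Pot am τ - Pot al τ) :
    ∃ f : I → A, Measurable f ∧ IsRPE lam u (diracProfile f) := by
  obtain ⟨ν, hν⟩ := exists_fullSupportOnSimplex A
  have := hν.1
  obtain ⟨G, hGae, hGm, hG⟩ := hpot.exists_measurable_mem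
  obtain ⟨i₀, hi₀⟩ := nonempty_of_mem hGae
  obtain ⟨x, hx, htremble⟩ := exists_trembling_limit (u i₀) (hu.1 i₀) fun a => payM (u i₀) a ν
  obtain ⟨f, hf, hfpos, hfx⟩ := hatomless.exists_measurable_real_preimage_eq x hx.1
    (B := Finset.univ.filter fun a => 0 < x a) (by
      by_contra h
      simp only [Finset.not_nonempty_iff_eq_empty, Finset.filter_eq_empty_iff, Finset.mem_univ,
        true_imp_iff, not_lt] at h
      linarith [hx.2, Finset.sum_nonpos fun a (_ : a ∈ Finset.univ) => @h a])
    MeasurableSet.univ (by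
      rw [probReal_univ, ← hx.2]
      exact Finset.sum_filter_of_ne fun a _ h => lt_of_le_of_ne (hx.1 a) (Ne.symm h))
  simp only [Finset.mem_filter, Finset.mem_univ, true_and, Set.univ_inter] at hfpos hfx
  have hsoc : socSum lam (diracProfile f) = x := by
    ext a
    rw [socSum_diracProfile lam hf]
    rcases (hx.1 a).eq_or_lt with h0 | h0
    · have : f ⁻¹' {a} = ∅ := Set.eq_empty_of_forall_notMem fun i hi =>
        (hfpos i).ne (h0.trans (congrArg x (Set.mem_singleton_iff.1 hi)).symm)
      rw [this, measureReal_empty, h0]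
    · exact hfx a h0
  set ε : ℕ → ℝ := fun n => 1 / ((n : ℝ) + 1) with hε
  have hε0 : ∀ n, 0 < ε n := fun n => by positivity
  have hε1 : ∀ n, ε n ≤ 1 := fun n => by
    rw [hε, div_le_one (by positivity)]
    linarith [Nat.cast_nonneg (α := ℝ) n]
  have hεlim : Tendsto ε atTop (𝓝 0) := tendsto_one_div_add_atTop_nhds_zero_nat
  choose δ hδ0 hδ1 hδε τ hτΔ hτx hτlt hτopt using fun n => htremble (ε n) (hε0 n)
  have hτlim : Tendsto τ atTop (𝓝 x) :=
    tendsto_iff_dist_tendsto_zero.2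
      (squeeze_zero (fun _ => dist_nonneg) (fun n => (hτx n).le) hεlim)
  have hpos : ∀ n i a, 0 < trembleProfile f x (τ n) (ε n) i a := fun n i a => by
    have h1 := mul_nonneg (sub_nonneg.2 (hε1 n)) ((diracProfile_mem_stdSimplex f i).1 a)
    have h2 := hτlt n a
    simp only [trembleProfile]
    linarith
  have hpay : ∀ n i a, payM (u i) a (mixDirac (δ n) ν (τ n)) =
      (1 - δ n) * u i a (τ n) + δ n * payM (u i) a ν := fun n i a =>
    integral_mixDirac (hδ0 n).le (hδ1 n)
      (integrable_of_continuousOn_stdSimplex hν.2.1 (hu.1 i a)) _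
  refine ⟨f, hf, ⟨measurable_diracProfile hf, diracProfile_mem_stdSimplex f⟩, ε,
    fun n => trembleProfile f x (τ n) (ε n), fun _ => G, fun n => mixDirac (δ n) ν, hε0, hεlim,
    fun n => ?_, ?_, ?_⟩
  · refine ⟨isProfile_trembleProfile lam hf hx (hτΔ n) (hpos n),
      Eventually.of_forall (hpos n), hGm, ?_, isPerturbation_mixDirac (hδ0 n) (hδ1 n) hν,
      fun σ _ => ofReal_le_mixDirac_singleton (hδε n) ν σ, fun i hi am al hlt => ?_⟩
    · rw [prob_compl_eq_zero_iff hGm |>.1 (mem_ae_iff.1 hGae)]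
      exact ENNReal.ofReal_lt_one.2 (by linarith [hε0 n])
    · rw [socSum_trembleProfile lam hf hsoc, hpay, hpay] at hlt
      have hdiff : ∀ σ ∈ stdSimplex ℝ A, u i am σ - u i al σ = u i₀ am σ - u i₀ al σ :=
        fun σ hσ => (hG i hi am al σ hσ).trans (hG i₀ hi₀ am al σ hσ).symm
      have h1 := hdiff _ (hτΔ n)
      have h2 := payM_sub_payM_eq hν.2.1 (hu.1 i) (hu.1 i₀) hdiff
      obtain ⟨hxa, hτa⟩ := hτopt n am ⟨al, by
        linear_combination hlt - (1 - δ n) * h1 - δ n * h2⟩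
      have hne : am ≠ f i := fun h => (hfpos i).ne' (h ▸ hxa)
      simpa [trembleProfile, diracProfile, hne, hxa] using hτa
  · filter_upwards [hGae] with i hi
    exact ⟨id, strictMono_id, fun _ => hi, tendsto_trembleProfile f hτlim hεlim i⟩
  · simpa only [socSum_trembleProfile lam hf hsoc, hsoc] using hτlim
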